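/- Let H_1, H_2 ∈ M_n(ℂ) be Hermitian matrices with ‖H_1² + H_2² − I‖ ≤ δ and ‖[H_1,H_2]‖ ≤ δ, where 0 < δ ≤ 3/10. Then there exist Hermitian matrices K_1, K_2 ∈ M_n(ℂ) with K_1 K_2 = K_2 K_1, K_1² + K_2² = I, and ‖K_r − H_r‖ ≤ 2δ for r = 1,2. Moreover, if n = 2N and both H_1 and H_2 are self-dual, then K_1 and K_2 can be chosen self-dual; and if both H_1 and H_2 have real entries, then K_1 and K_2 can be chosen with real entries. -/

import Mathlib

open Matrix
open scoped Kronecker ComplexOrder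

/-- The ℓ²→ℓ² operator norm of a complex matrix. -/
noncomputable def opNorm {n : Type*} [Fintype n] [DecidableEq n] (A : Matrix n n ℂ) : ℝ :=
  ‖Matrix.toEuclideanCLM (𝕜 := ℂ) (n := n) A‖

/-- The 2N×2N matrix `Z = [[0, -I],[I, 0]]`. -/
noncomputable def Zmat (N : ℕ) : Matrix (Fin N ⊕ Fin N) (Fin N ⊕ Fin N) ℂ :=
  Matrix.fromBlocks 0 (-1) 1 0

/-- The dual `X♯ = -Z Xᵀ Z` of a 2N×2N complex matrix. -/
noncomputable def dual {N : ℕ} (X : Matrix (Fin N ⊕ Fin N) (Fin N ⊕ Fin N) ℂ) :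
    Matrix (Fin N ⊕ Fin N) (Fin N ⊕ Fin N) ℂ :=
  -(Zmat N) * Xᵀ * (Zmat N)

open scoped Matrix.Norms.L2Operator MatrixOrder in
lemma scc_norm {n : Type*} [Fintype n] [DecidableEq n] (P : Matrix n n ℂ) (hP : 0 ≤ P) :
    ‖P - 1‖ ≤ ‖P * P - 1‖ := by
  have hs : Pᴴ = P := (Matrix.nonneg_iff_posSemidef.mp hP).isHermitian
  have h1 : ‖(P - 1)ᴴ * (P - 1)‖ = ‖P - 1‖ * ‖P - 1‖ := CStarRing.norm_star_mul_self
  have h2 : ‖(P * P - 1)ᴴ * (P * P - 1)‖ = ‖P * P - 1‖ * ‖P * P - 1‖ :=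
    CStarRing.norm_star_mul_self
  have hle : (P - 1)ᴴ * (P - 1) ≤ (P * P - 1)ᴴ * (P * P - 1) := by
    rw [← sub_nonneg]
    have e : (P * P - 1)ᴴ * (P * P - 1) - (P - 1)ᴴ * (P - 1)
        = (P - 1)ᴴ * (Pᴴ * P + (P + P)) * (P - 1) := by
      simp only [conjTranspose_sub, conjTranspose_mul, conjTranspose_one, hs]
      noncomm_ring
    rw [e]
    have : 0 ≤ Pᴴ * P + (P + P) :=
      add_nonneg (Matrix.nonneg_iff_posSemidef.mpr (posSemidef_conjTranspose_mul_self P))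
        (add_nonneg hP hP)
    exact Matrix.nonneg_iff_posSemidef.mpr
      ((Matrix.nonneg_iff_posSemidef.mp this).conjTranspose_mul_mul_same _)
  have h0 : 0 ≤ (P - 1)ᴴ * (P - 1) :=
    Matrix.nonneg_iff_posSemidef.mpr (posSemidef_conjTranspose_mul_self _)
  have := CStarAlgebra.norm_le_norm_of_nonneg_of_le h0 hle
  rw [h1, h2] at this
  nlinarith [norm_nonneg (P - 1), norm_nonneg (P * P - 1)]

open scoped Matrix.Norms.L2Operator MatrixOrder in
lemma scc_polar {n : Type*} [Fintype n] [DecidableEq n] (A : Matrix n n ℂ) (ε : ℝ) (hε : ε < 1)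
    (h : ‖Aᴴ * A - 1‖ ≤ ε) :
    ∃ U P : Matrix n n ℂ, 0 ≤ P ∧ IsUnit P ∧ P * P = Aᴴ * A ∧ U * P = A ∧ Uᴴ * U = 1 ∧
      U * Uᴴ = 1 ∧ ‖U - A‖ ≤ ε := by
  have hA : 0 ≤ Aᴴ * A := Matrix.nonneg_iff_posSemidef.mpr (posSemidef_conjTranspose_mul_self A)
  obtain ⟨P, hP, hPP⟩ : ∃ P : Matrix n n ℂ, 0 ≤ P ∧ P * P = Aᴴ * A :=
    ⟨CFC.sqrt (Aᴴ * A), CFC.sqrt_nonneg _, CFC.sqrt_mul_sqrt_self _ hA⟩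
  have hs : Pᴴ = P := (Matrix.nonneg_iff_posSemidef.mp hP).isHermitian
  have hn : ‖P - 1‖ ≤ ε := (scc_norm P hP).trans (by rwa [hPP])
  have hu : IsUnit P := by
    have := isUnit_one_sub_of_norm_lt_one (x := 1 - P) (by rw [norm_sub_rev]; linarith)
    simpa using this
  have hd : IsUnit P.det := (Matrix.isUnit_iff_isUnit_det P).mp hu
  have hUP : A * P⁻¹ * P = A := by rw [mul_assoc, nonsing_inv_mul _ hd, mul_one]
  have hUU : (A * P⁻¹)ᴴ * (A * P⁻¹) = 1 := by
    rw [conjTranspose_mul, conjTranspose_nonsing_inv, hs]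
    calc P⁻¹ * Aᴴ * (A * P⁻¹) = P⁻¹ * (Aᴴ * A) * P⁻¹ := by simp only [mul_assoc]
      _ = (P⁻¹ * P) * (P * P⁻¹) := by rw [← hPP]; simp only [mul_assoc]
      _ = 1 := by rw [nonsing_inv_mul _ hd, mul_nonsing_inv _ hd, mul_one]
  refine ⟨A * P⁻¹, P, hP, hu, hPP, hUP, hUU, mul_eq_one_comm.mp hUU, ?_⟩
  have e : A * P⁻¹ - A = (A * P⁻¹) * (1 - P) := by rw [mul_sub, hUP, mul_one]
  have h1 : ‖A * P⁻¹ - A‖ * ‖A * P⁻¹ - A‖ = ‖1 - P‖ * ‖1 - P‖ := by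
    have a : ‖(A * P⁻¹ - A)ᴴ * (A * P⁻¹ - A)‖ = ‖A * P⁻¹ - A‖ * ‖A * P⁻¹ - A‖ :=
      CStarRing.norm_star_mul_self
    have b : ‖(1 - P)ᴴ * (1 - P)‖ = ‖1 - P‖ * ‖1 - P‖ := CStarRing.norm_star_mul_self
    rw [← a, ← b]
    congr 1
    rw [e, conjTranspose_mul]
    calc _ = (1 - P)ᴴ * ((A * P⁻¹)ᴴ * (A * P⁻¹)) * (1 - P) := by simp only [mul_assoc]
      _ = _ := by rw [hUU, mul_one]
  rw [norm_sub_rev] at hn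
  nlinarith [norm_nonneg (1 - P), norm_nonneg (A * P⁻¹ - A)]

open scoped Matrix.Norms.L2Operator MatrixOrder in
lemma scc_sym {n : Type*} [Fintype n] [DecidableEq n] (A U P : Matrix n n ℂ)
    (hP : 0 ≤ P) (hu : IsUnit P) (hPP : P * P = Aᴴ * A) (hUP : U * P = A)
    (hUU' : U * Uᴴ = 1) (φ : Matrix n n ℂ → Matrix n n ℂ)
    (hmul : ∀ X Y, φ (X * Y) = φ Y * φ X) (hone : φ 1 = 1) (hstar : ∀ X, φ Xᴴ = (φ X)ᴴ)
    (hA : φ A = A) : φ U = U := by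
  have hs : Pᴴ = P := (Matrix.nonneg_iff_posSemidef.mp hP).isHermitian
  have hA' : φ P * φ U = A := by rw [← hmul, hUP, hA]
  have hφP : (φ P)ᴴ = φ P := by rw [← hstar, hs]
  have h1 : (φ U)ᴴ * φ U = 1 := by rw [← hstar, ← hmul, hUU', hone]
  have h2 : φ U * (φ U)ᴴ = 1 := mul_eq_one_comm.mp h1
  have hpos : 0 ≤ φ P := by
    have hR : CFC.sqrt P * CFC.sqrt P = P := CFC.sqrt_mul_sqrt_self _ hP
    have hRs : (CFC.sqrt P)ᴴ = CFC.sqrt P :=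
      (Matrix.nonneg_iff_posSemidef.mp (CFC.sqrt_nonneg P)).isHermitian
    rw [← hR, hmul]
    nth_rewrite 1 [← hRs]
    rw [hstar]
    exact Matrix.nonneg_iff_posSemidef.mpr (posSemidef_conjTranspose_mul_self _)
  have hQ : 0 ≤ (φ U)ᴴ * φ P * φ U := Matrix.nonneg_iff_posSemidef.mpr
      ((Matrix.nonneg_iff_posSemidef.mp hpos).conjTranspose_mul_mul_same _)
  have hQQ : ((φ U)ᴴ * φ P * φ U) * ((φ U)ᴴ * φ P * φ U) = Aᴴ * A := by
    calc _ = (φ U)ᴴ * φ P * (φ U * (φ U)ᴴ) * (φ P * φ U) := by simp only [mul_assoc]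
      _ = (φ P * φ U)ᴴ * (φ P * φ U) := by rw [h2, mul_one, conjTranspose_mul, hφP]
      _ = _ := by rw [hA']
  have hPQ : P = (φ U)ᴴ * φ P * φ U :=
    (CFC.sqrt_unique hPP hP).symm.trans (CFC.sqrt_unique hQQ hQ)
  have : φ U * P = U * P := by
    rw [hUP]
    calc _ = φ U * ((φ U)ᴴ * φ P * φ U) := congrArg (φ U * ·) hPQ
      _ = (φ U * (φ U)ᴴ) * (φ P * φ U) := by simp only [mul_assoc]
      _ = _ := by rw [h2, one_mul, hA']
  exact hu.mul_right_cancel this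

open scoped Matrix.Norms.L2Operator MatrixOrder in
lemma scc_main {n : Type*} [Fintype n] [DecidableEq n] (δ : ℝ) (hδ : δ ≤ 3 / 10)
    (H₁ H₂ : Matrix n n ℂ) (hH₁ : H₁ᴴ = H₁) (hH₂ : H₂ᴴ = H₂)
    (h1 : opNorm (H₁ * H₁ + H₂ * H₂ - 1) ≤ δ) (h2 : opNorm (H₁ * H₂ - H₂ * H₁) ≤ δ) :
    ∃ K₁ K₂ : Matrix n n ℂ, K₁ᴴ = K₁ ∧ K₂ᴴ = K₂ ∧
      K₁ * K₂ = K₂ * K₁ ∧ K₁ * K₁ + K₂ * K₂ = 1 ∧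
      opNorm (K₁ - H₁) ≤ 2 * δ ∧ opNorm (K₂ - H₂) ≤ 2 * δ ∧
      ∀ φ : Matrix n n ℂ → Matrix n n ℂ, (∀ X Y, φ (X + Y) = φ X + φ Y) →
        (∀ (c : ℂ) X, φ (c • X) = c • φ X) →
        (∀ X Y, φ (X * Y) = φ Y * φ X) → φ 1 = 1 → (∀ X, φ Xᴴ = (φ X)ᴴ) →
        φ H₁ = H₁ → φ H₂ = H₂ → φ K₁ = K₁ ∧ φ K₂ = K₂ := by
  have hop : ∀ X : Matrix n n ℂ, opNorm X = ‖X‖ := fun X => (Matrix.l2_opNorm_def X).symm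
  simp only [hop] at *
  have hAs : (H₁ + Complex.I • H₂)ᴴ = H₁ + (-Complex.I) • H₂ := by
    simp [hH₁, hH₂]
  have hI : Complex.I * Complex.I = -1 := Complex.I_mul_I
  have hAA : ‖(H₁ + Complex.I • H₂)ᴴ * (H₁ + Complex.I • H₂) - 1‖ ≤ 2 * δ := by
    have e : (H₁ + Complex.I • H₂)ᴴ * (H₁ + Complex.I • H₂) - 1
        = (H₁ * H₁ + H₂ * H₂ - 1) + Complex.I • (H₁ * H₂ - H₂ * H₁) := by
      rw [hAs]
      simp only [add_mul, mul_add, smul_mul_assoc, mul_smul_comm, smul_add]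
      match_scalars <;> first | ring1 | linear_combination (-1 : ℂ) * hI
    rw [e]
    refine (norm_add_le _ _).trans ?_
    rw [norm_smul, Complex.norm_I, one_mul]
    linarith
  obtain ⟨U, P, hP, hu, hPP, hUP, hUU, hUU', hn⟩ :=
    scc_polar (H₁ + Complex.I • H₂) (2 * δ) (by linarith) hAA
  have hn' : ‖Uᴴ - (H₁ + Complex.I • H₂)ᴴ‖ ≤ 2 * δ := by
    rw [← conjTranspose_sub, Matrix.l2_opNorm_conjTranspose]; exact hn
  have hI2 : (Complex.I / 2) * (Complex.I / 2) = -(1 / 4) := by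
    rw [div_mul_div_comm, hI]; norm_num
  have half : ∀ X Y : Matrix n n ℂ, ∀ c d : ℂ, ‖c‖ = 1 / 2 → ‖d‖ = 1 / 2 → ‖X‖ ≤ 2 * δ →
      ‖Y‖ ≤ 2 * δ → ‖c • X + d • Y‖ ≤ 2 * δ := by
    intro X Y c d hc hd hX hY
    refine (norm_add_le _ _).trans ?_
    rw [norm_smul, norm_smul, hc, hd]
    linarith
  refine ⟨(1 / 2 : ℂ) • U + (1 / 2 : ℂ) • Uᴴ, (-(Complex.I / 2)) • U + (Complex.I / 2) • Uᴴ,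
    ?_, ?_, ?_, ?_, ?_, ?_, ?_⟩
  · simp [add_comm]
  · simp only [conjTranspose_add, conjTranspose_smul, conjTranspose_conjTranspose, star_neg,
      star_div₀, Complex.star_def, Complex.conj_I, map_ofNat]
    module
  · simp only [add_mul, mul_add, smul_mul_assoc, mul_smul_comm, hUU, hUU']
    module
  · simp only [add_mul, mul_add, smul_mul_assoc, mul_smul_comm, smul_add, hUU, hUU']
    match_scalars <;> first
      | ring1
      | linear_combination (1 / 4 : ℂ) * hI
      | linear_combination (-1 / 4 : ℂ) * hI
      | linear_combination (-1 / 2 : ℂ) * hI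
  · have e : (1 / 2 : ℂ) • U + (1 / 2 : ℂ) • Uᴴ - H₁ = (1 / 2 : ℂ) • (U - (H₁ + Complex.I • H₂))
        + (1 / 2 : ℂ) • (Uᴴ - (H₁ + Complex.I • H₂)ᴴ) := by
      rw [hAs]; module
    rw [e]
    exact half _ _ _ _ (by norm_num) (by norm_num) hn hn'
  · have e : (-(Complex.I / 2)) • U + (Complex.I / 2) • Uᴴ - H₂
        = (-(Complex.I / 2)) • (U - (H₁ + Complex.I • H₂))
        + (Complex.I / 2) • (Uᴴ - (H₁ + Complex.I • H₂)ᴴ) := by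
      rw [hAs]
      have : ∀ X : Matrix n n ℂ, X = -((Complex.I * Complex.I) • X) := by
        intro X; rw [hI]; simp
      nth_rewrite 1 [this H₂]
      module
    rw [e]
    exact half _ _ _ _ (by simp) (by simp) hn hn'
  · intro φ hadd hsmul hmul hone hstar hφ₁ hφ₂
    have hU : φ U = U := scc_sym _ U P hP hu hPP hUP hUU' φ hmul hone hstar
      (by rw [hadd, hsmul, hφ₁, hφ₂])
    constructor <;> simp only [hadd, hsmul, hstar, hU]

lemma scc_Z_mul (N : ℕ) : Zmat N * Zmat N = -1 := by
  simp [Zmat, fromBlocks_multiply, ← fromBlocks_one, fromBlocks_neg]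

lemma scc_Z_star (N : ℕ) : (Zmat N)ᴴ = -Zmat N := by
  simp [Zmat, fromBlocks_conjTranspose, fromBlocks_neg]

/-- a soft representation of the circle by Hermitian matrices can be corrected
to an exact one: if `‖H₁² + H₂² - I‖ ≤ δ` and `‖[H₁,H₂]‖ ≤ δ` with `0 < δ ≤ 3/10`, then
there are Hermitian `K₁, K₂` with `K₁K₂ = K₂K₁`, `K₁² + K₂² = I` and `‖K_r - H_r‖ ≤ 2δ`;
moreover self-duality (resp. realness) of the `H_r` can be preserved in the `K_r`. -/
theorem soft_circle_correction :
    (∀ (n : ℕ) (δ : ℝ), 0 < δ → δ ≤ 3 / 10 →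
      ∀ H₁ H₂ : Matrix (Fin n) (Fin n) ℂ, H₁ᴴ = H₁ → H₂ᴴ = H₂ →
        opNorm (H₁ * H₁ + H₂ * H₂ - 1) ≤ δ → opNorm (H₁ * H₂ - H₂ * H₁) ≤ δ →
        ∃ K₁ K₂ : Matrix (Fin n) (Fin n) ℂ, K₁ᴴ = K₁ ∧ K₂ᴴ = K₂ ∧
          K₁ * K₂ = K₂ * K₁ ∧ K₁ * K₁ + K₂ * K₂ = 1 ∧
          opNorm (K₁ - H₁) ≤ 2 * δ ∧ opNorm (K₂ - H₂) ≤ 2 * δ) ∧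
    (∀ (N : ℕ) (δ : ℝ), 0 < δ → δ ≤ 3 / 10 →
      ∀ H₁ H₂ : Matrix (Fin N ⊕ Fin N) (Fin N ⊕ Fin N) ℂ, H₁ᴴ = H₁ → H₂ᴴ = H₂ →
        dual H₁ = H₁ → dual H₂ = H₂ →
        opNorm (H₁ * H₁ + H₂ * H₂ - 1) ≤ δ → opNorm (H₁ * H₂ - H₂ * H₁) ≤ δ →
        ∃ K₁ K₂ : Matrix (Fin N ⊕ Fin N) (Fin N ⊕ Fin N) ℂ, K₁ᴴ = K₁ ∧ K₂ᴴ = K₂ ∧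
          dual K₁ = K₁ ∧ dual K₂ = K₂ ∧
          K₁ * K₂ = K₂ * K₁ ∧ K₁ * K₁ + K₂ * K₂ = 1 ∧
          opNorm (K₁ - H₁) ≤ 2 * δ ∧ opNorm (K₂ - H₂) ≤ 2 * δ) ∧
    (∀ (n : ℕ) (δ : ℝ), 0 < δ → δ ≤ 3 / 10 →
      ∀ H₁ H₂ : Matrix (Fin n) (Fin n) ℂ, H₁ᴴ = H₁ → H₂ᴴ = H₂ →
        (∀ i j, (H₁ i j).im = 0) → (∀ i j, (H₂ i j).im = 0) →
        opNorm (H₁ * H₁ + H₂ * H₂ - 1) ≤ δ → opNorm (H₁ * H₂ - H₂ * H₁) ≤ δ →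
        ∃ K₁ K₂ : Matrix (Fin n) (Fin n) ℂ, K₁ᴴ = K₁ ∧ K₂ᴴ = K₂ ∧
          (∀ i j, (K₁ i j).im = 0) ∧ (∀ i j, (K₂ i j).im = 0) ∧
          K₁ * K₂ = K₂ * K₁ ∧ K₁ * K₁ + K₂ * K₂ = 1 ∧
          opNorm (K₁ - H₁) ≤ 2 * δ ∧ opNorm (K₂ - H₂) ≤ 2 * δ) := by
  refine ⟨?_, ?_, ?_⟩
  · intro n δ _ hδ H₁ H₂ a b c d
    obtain ⟨K₁, K₂, h1, h2, h3, h4, h5, h6, _⟩ := scc_main δ hδ H₁ H₂ a b c d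
    exact ⟨K₁, K₂, h1, h2, h3, h4, h5, h6⟩
  · intro N δ _ hδ H₁ H₂ a b p q c d
    obtain ⟨K₁, K₂, h1, h2, h3, h4, h5, h6, h7⟩ := scc_main δ hδ H₁ H₂ a b c d
    have hZ := scc_Z_mul N
    obtain ⟨k1, k2⟩ := h7 dual
      (by intro X Y; simp [dual, mul_add, add_mul])
      (by intro r X; simp [dual])
      (by
        intro X Y
        simp only [dual, transpose_mul]
        calc _ = -Zmat N * Yᵀ * (-(-1)) * Xᵀ * Zmat N := by simp [mul_assoc]
          _ = _ := by rw [← hZ]; simp [mul_assoc])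
      (by simp [dual, hZ])
      (by
        intro X
        simp only [dual, conjTranspose_mul, conjTranspose_neg, scc_Z_star]
        simp only [neg_mul, mul_neg, mul_assoc, neg_neg]
        rfl)
      p q
    exact ⟨K₁, K₂, h1, h2, k1, k2, h3, h4, h5, h6⟩
  · intro n δ _ hδ H₁ H₂ a b p q c d
    obtain ⟨K₁, K₂, h1, h2, h3, h4, h5, h6, h7⟩ := scc_main δ hδ H₁ H₂ a b c d
    have tr : ∀ H : Matrix (Fin n) (Fin n) ℂ, Hᴴ = H → (∀ i j, (H i j).im = 0) → Hᵀ = H := by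
      intro H hH him
      ext i j
      have := congrFun (congrFun hH i) j
      rw [conjTranspose_apply] at this
      rw [transpose_apply, ← this]
      exact (Complex.conj_eq_iff_im.mpr (him j i)).symm
    have rt : ∀ H : Matrix (Fin n) (Fin n) ℂ, Hᴴ = H → Hᵀ = H → (∀ i j, (H i j).im = 0) := by
      intro H hH hT i j
      have h := congrFun (congrFun hH j) i
      have h' := congrFun (congrFun hT j) i
      rw [conjTranspose_apply] at h
      rw [transpose_apply] at h'
      exact Complex.conj_eq_iff_im.mp (h.trans h'.symm)
    obtain ⟨k1, k2⟩ := h7 transpose (by simp) (by simp) (by simp) (by simp)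
      (by intro X; rfl) (tr _ a p) (tr _ b q)
    exact ⟨K₁, K₂, h1, h2, rt _ h1 k1, rt _ h2 k2, h3, h4, h5, h6⟩
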